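/- Fix b > 0 and m ∈ ℝ, and define v(x) := −(r/(r+q))·(Zbar(b−x) + m/q) − Zqr(b−x)/φ for x ∈ ℝ. Then v is twice differentiable on ℝ with v′(x) = Zqr(b−x) > 0 and v″(x) = −(q/(r+q))·φ·J(b−x) < 0 for every x; in particular v is strictly increasing and strictly concave, and v′(b) = 1. -/

import Mathlib

open MeasureTheory Real Set Filter Topology

/-- `Wbar x = ∫_0^x W(z) dz`. -/
noncomputable def Wbar (W : ℝ → ℝ) (x : ℝ) : ℝ := ∫ z in (0:ℝ)..x, W z

/-- `Zq x = 1 + q · Wbar x`. -/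
noncomputable def Zq (q : ℝ) (W : ℝ → ℝ) (x : ℝ) : ℝ := 1 + q * Wbar W x

/-- `Zbar x = ∫_0^x Zq(z) dz`. -/
noncomputable def Zbar (q : ℝ) (W : ℝ → ℝ) (x : ℝ) : ℝ := ∫ z in (0:ℝ)..x, Zq q W z

/-- `J x = e^{φx} (1 − r ∫_0^x e^{−φz} W(z) dz)`. -/
noncomputable def Jfun (r φ : ℝ) (W : ℝ → ℝ) (x : ℝ) : ℝ :=
  Real.exp (φ * x) * (1 - r * ∫ z in (0:ℝ)..x, Real.exp (-φ * z) * W z)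

/-- `Zqr x = (r/(r+q)) Zq x + (q/(r+q)) J x`. -/
noncomputable def Zqr (q r φ : ℝ) (W : ℝ → ℝ) (x : ℝ) : ℝ :=
  (r / (r + q)) * Zq q W x + (q / (r + q)) * Jfun r φ W x

theorem continuousAt_of_ne_zero {W : ℝ → ℝ} (hWneg : ∀ x < (0:ℝ), W x = 0)
    (hWcont : ContinuousOn W (Set.Ioi 0)) {y : ℝ} (hy : y ≠ 0) : ContinuousAt W y := by
  rcases lt_or_gt_of_ne hy with h | h
  · have he : W =ᶠ[𝓝 y] fun _ => (0:ℝ) := by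
      filter_upwards [Iio_mem_nhds h] with x hx using hWneg x hx
    exact continuousAt_const.congr he.symm
  · exact hWcont.continuousAt (Ioi_mem_nhds h)

theorem integrable_exp_mul {φ : ℝ} {W : ℝ → ℝ} (hWneg : ∀ x < (0:ℝ), W x = 0)
    (hWint : IntegrableOn (fun z => Real.exp (-φ * z) * W z) (Set.Ioi 0)) :
    Integrable (fun z => Real.exp (-φ * z) * W z) := by
  have h0 : IntegrableOn (fun z => Real.exp (-φ * z) * W z) (Set.Iio 0) :=
    integrableOn_zero.congr_fun (fun x hx => by simp [hWneg x hx]) measurableSet_Iio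
  rw [← integrableOn_univ, ← Set.Iic_union_Ioi (a := (0:ℝ))]
  exact ((integrableOn_Iic_iff_integrableOn_Iio (b := (0:ℝ))).mpr h0).union hWint

theorem locallyIntegrable_of_integrable_exp_mul {φ : ℝ} {W : ℝ → ℝ}
    (h : Integrable (fun z => Real.exp (-φ * z) * W z)) : LocallyIntegrable W := by
  have hc : Continuous fun z : ℝ => Real.exp (φ * z) := by fun_prop
  have hW : W = fun z => Real.exp (φ * z) * (Real.exp (-φ * z) * W z) := by
    funext z
    rw [← mul_assoc, ← Real.exp_add]
    simp
  rw [hW, ← locallyIntegrableOn_univ]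
  exact (h.locallyIntegrable.locallyIntegrableOn _).continuousOn_mul hc.continuousOn
    isOpen_univ.isLocallyClosed

theorem intervalIntegrable_of_locallyIntegrable {f : ℝ → ℝ} (hf : LocallyIntegrable f) (a b : ℝ) :
    IntervalIntegrable f volume a b :=
  (hf.integrableOn_isCompact isCompact_uIcc).intervalIntegrable

theorem hasDerivAt_primitive {f : ℝ → ℝ} (hf : LocallyIntegrable f) {y : ℝ}
    (hy : ContinuousAt f y) : HasDerivAt (fun x => ∫ z in (0:ℝ)..x, f z) (f y) y :=
  intervalIntegral.integral_hasDerivAt_right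
    (intervalIntegrable_of_locallyIntegrable hf _ _)
    hf.aestronglyMeasurable.stronglyMeasurableAtFilter hy

theorem continuous_primitive_of_locallyIntegrable {f : ℝ → ℝ} (hf : LocallyIntegrable f) :
    Continuous fun x => ∫ z in (0:ℝ)..x, f z :=
  intervalIntegral.continuous_primitive (intervalIntegrable_of_locallyIntegrable hf) 0

theorem Jfun_pos {r φ : ℝ} {W : ℝ → ℝ} (hr : 0 < r)
    (hWneg : ∀ x < (0:ℝ), W x = 0) (hWnn : ∀ x : ℝ, 0 ≤ W x)
    (hWmono : StrictMonoOn W (Set.Ioi 0))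
    (hWint : IntegrableOn (fun z => Real.exp (-φ * z) * W z) (Set.Ioi 0))
    (hWlap : r * ∫ z in Set.Ioi (0:ℝ), Real.exp (-φ * z) * W z = 1) (y : ℝ) :
    0 < Jfun r φ W y := by
  have hint := integrable_exp_mul hWneg hWint
  have hnn : ∀ z, 0 ≤ Real.exp (-φ * z) * W z := fun z =>
    mul_nonneg (Real.exp_pos _).le (hWnn z)
  refine mul_pos (Real.exp_pos _) ?_
  have hsub := intervalIntegral.integral_interval_add_Ioi (a := (0:ℝ)) (b := y)
    hint.integrableOn hint.integrableOn
  have htail : 0 < ∫ z in Set.Ioi y, Real.exp (-φ * z) * W z := by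
    rw [setIntegral_pos_iff_support_of_nonneg_ae (ae_of_all _ hnn) hint.integrableOn]
    refine lt_of_lt_of_le ?_ (measure_mono
      (show Set.Ioi (max y 0) ⊆ _ from fun z hz =>
        ⟨?_, (le_max_left y 0).trans_lt (Set.mem_Ioi.mp hz)⟩))
    · simp
    · have hz0 : 0 < z := (le_max_right _ _).trans_lt hz
      have hlt : W (z / 2) < W z :=
        hWmono (Set.mem_Ioi.mpr (half_pos hz0)) hz0 (half_lt_self hz0)
      exact (mul_pos (Real.exp_pos _) ((hWnn _).trans_lt hlt)).ne'
  have := mul_pos hr htail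
  rw [← hsub] at hWlap
  linarith

theorem Zq_pos {q : ℝ} {W : ℝ → ℝ} (hq : 0 < q) (hWneg : ∀ x < (0:ℝ), W x = 0)
    (hWnn : ∀ x : ℝ, 0 ≤ W x) (y : ℝ) : 0 < Zq q W y := by
  have h : 0 ≤ Wbar W y := by
    unfold Wbar
    rcases le_total 0 y with h | h
    · exact intervalIntegral.integral_nonneg h fun z _ => hWnn z
    · rw [intervalIntegral.integral_symm, intervalIntegral.integral_of_le h,
        integral_Ioc_eq_integral_Ioo, setIntegral_congr_fun measurableSet_Ioo
        (g := fun _ => (0:ℝ)) fun z hz => hWneg z hz.2]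
      simp
  have := mul_nonneg hq.le h
  unfold Zq
  linarith

theorem continuous_Zq {q : ℝ} {W : ℝ → ℝ} (hW : LocallyIntegrable W) : Continuous (Zq q W) := by
  have h : Continuous (Wbar W) := continuous_primitive_of_locallyIntegrable hW
  unfold Zq
  fun_prop

theorem continuous_Jfun {r φ : ℝ} {W : ℝ → ℝ}
    (hint : Integrable (fun z => Real.exp (-φ * z) * W z)) : Continuous (Jfun r φ W) := by
  have h := continuous_primitive_of_locallyIntegrable hint.locallyIntegrable
  unfold Jfun
  fun_prop

theorem hasDerivAt_Jfun {r φ : ℝ} {W : ℝ → ℝ}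
    (hint : Integrable (fun z => Real.exp (-φ * z) * W z)) {y : ℝ} (hy : ContinuousAt W y) :
    HasDerivAt (Jfun r φ W) (φ * Jfun r φ W y - r * W y) y := by
  have hc : ContinuousAt (fun z => Real.exp (-φ * z) * W z) y := by fun_prop
  have hE : HasDerivAt (fun x : ℝ => Real.exp (φ * x)) (Real.exp (φ * y) * φ) y := by
    simpa using ((hasDerivAt_id y).const_mul φ).exp
  have h := hE.mul (((hasDerivAt_primitive hint.locallyIntegrable hc).const_mul r).const_sub 1)
  refine h.congr_deriv ?_
  have he : Real.exp (φ * y) * Real.exp (-φ * y) = 1 := by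
    rw [← Real.exp_add]
    simp
  unfold Jfun
  linear_combination -r * W y * he

/-- The kinks of `Zq` and `Jfun` at `0` cancel, so `Zqr` is differentiable on the whole line. -/
theorem hasDerivAt_Zqr {q r φ : ℝ} {W : ℝ → ℝ} (hWneg : ∀ x < (0:ℝ), W x = 0)
    (hWcont : ContinuousOn W (Set.Ioi 0))
    (hint : Integrable (fun z => Real.exp (-φ * z) * W z)) (y : ℝ) :
    HasDerivAt (Zqr q r φ W) (q / (r + q) * φ * Jfun r φ W y) y := by
  have hW := locallyIntegrable_of_integrable_exp_mul hint
  have hZ := continuous_Zq (q := q) hW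
  have hJ := continuous_Jfun (r := r) hint
  have hne : ∀ x ≠ (0:ℝ), HasDerivAt (Zqr q r φ W) (q / (r + q) * φ * Jfun r φ W x) x := by
    intro x hx
    have hc := continuousAt_of_ne_zero hWneg hWcont hx
    have hZ' : HasDerivAt (Zq q W) (q * W x) x :=
      ((hasDerivAt_primitive hW hc).const_mul q).const_add 1
    refine ((hZ'.const_mul (r / (r + q))).add
      ((hasDerivAt_Jfun hint hc).const_mul (q / (r + q)))).congr_deriv ?_
    ring
  rcases eq_or_ne y 0 with rfl | hy
  · refine hasDerivAt_of_hasDerivAt_of_ne hne ?_ ?_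
    · unfold Zqr
      fun_prop
    · fun_prop
  · exact hne y hy

/-- with v(x) = −(r/(r+q))(Zbar(b−x)+m/q) − Zqr(b−x)/φ, v is twice differentiable with
v′(x) = Zqr(b−x) > 0 and v″(x) = −(q/(r+q))·φ·J(b−x) < 0; v is strictly increasing and strictly
concave, and v′(b) = 1. -/
theorem v_smoothfit_increasing_concave
    (q r φ : ℝ) (W : ℝ → ℝ)
    (hq : 0 < q) (hr : 0 < r) (hφ : 0 < φ)
    (hWneg : ∀ x < (0:ℝ), W x = 0)
    (hWnn : ∀ x : ℝ, 0 ≤ W x)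
    (hWcont : ContinuousOn W (Set.Ioi 0))
    (hWmono : StrictMonoOn W (Set.Ioi 0))
    (W0 : ℝ)
    (hW0 : Filter.Tendsto W (nhdsWithin 0 (Set.Ioi 0)) (nhds W0))
    (hWint : MeasureTheory.IntegrableOn (fun z => Real.exp (-φ * z) * W z) (Set.Ioi 0))
    (hWlap : r * ∫ z in Set.Ioi (0:ℝ), Real.exp (-φ * z) * W z = 1)
    (b : ℝ) (hb : 0 < b) (m : ℝ)
    (v : ℝ → ℝ)
    (hv : ∀ x : ℝ, v x = -(r / (r + q)) * (Zbar q W (b - x) + m / q) - Zqr q r φ W (b - x) / φ)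
    : (∀ x : ℝ, HasDerivAt v (Zqr q r φ W (b - x)) x) ∧
      (∀ x : ℝ, HasDerivAt (fun y => Zqr q r φ W (b - y)) (-(q / (r + q) * φ * Jfun r φ W (b - x))) x) ∧
      (∀ x : ℝ, 0 < Zqr q r φ W (b - x)) ∧
      (∀ x : ℝ, -(q / (r + q) * φ * Jfun r φ W (b - x)) < 0) ∧
      StrictMono v ∧ StrictConcaveOn ℝ Set.univ v ∧
      HasDerivAt v 1 b := by
  have hint := integrable_exp_mul hWneg hWint
  have hW := locallyIntegrable_of_integrable_exp_mul hint
  have hJpos := Jfun_pos hr hWneg hWnn hWmono hWint hWlap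
  have hrefl : ∀ x, HasDerivAt (fun y : ℝ => b - y) (-1) x := fun x =>
    (hasDerivAt_id x).const_sub b
  have hd2 : ∀ x, HasDerivAt (fun y => Zqr q r φ W (b - y))
      (-(q / (r + q) * φ * Jfun r φ W (b - x))) x := fun x =>
    ((hasDerivAt_Zqr hWneg hWcont hint (b - x)).comp x (hrefl x)).congr_deriv (by ring)
  have hd1 : ∀ x, HasDerivAt v (Zqr q r φ W (b - x)) x := by
    intro x
    have hZbar : HasDerivAt (fun y => Zbar q W (b - y)) (Zq q W (b - x) * -1) x :=
      (hasDerivAt_primitive (continuous_Zq hW).locallyIntegrable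
        (continuous_Zq hW).continuousAt).comp x (hrefl x)
    rw [funext hv]
    refine (((hZbar.add_const (m / q)).const_mul (-(r / (r + q)))).sub
      ((hd2 x).div_const φ)).congr_deriv ?_
    unfold Zqr
    field_simp
    ring
  have hpos : ∀ x, 0 < Zqr q r φ W (b - x) := fun x =>
    add_pos (mul_pos (by positivity) (Zq_pos hq hWneg hWnn _)) (mul_pos (by positivity) (hJpos _))
  have hneg : ∀ x, -(q / (r + q) * φ * Jfun r φ W (b - x)) < 0 := fun x =>
    neg_neg_of_pos (mul_pos (by positivity) (hJpos _))
  have hderiv : deriv v = fun x => Zqr q r φ W (b - x) := funext fun x => (hd1 x).deriv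
  refine ⟨hd1, hd2, hpos, hneg, strictMono_of_deriv_pos fun x => ?_,
    strictConcaveOn_univ_of_deriv2_neg
      (continuous_iff_continuousAt.mpr fun x => (hd1 x).continuousAt) fun x => ?_, ?_⟩
  · rw [hderiv]
    exact hpos x
  · simp only [Function.iterate_succ, Function.iterate_zero, Function.comp_apply, id, hderiv]
    rw [(hd2 x).deriv]
    exact hneg x
  · refine (hd1 b).congr_deriv ?_
    simp only [Zqr, Zq, Wbar, Jfun, sub_self, intervalIntegral.integral_same, mul_zero,
      Real.exp_zero, add_zero, sub_zero, mul_one]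
    field_simp
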